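/- Let (H_n(x))_{n≥0} be the sequence of real polynomials defined by H_{n+1}(x) = (2nx^2+x+1)·H_n(x) + 2x(1−x^2)·H_n′(x) with H_0(x) = 1. Then for every n ≥ 0, H_n(x) = U_n(x^2) + x·V_n(x^2), where U_n(x) = Σ_{π∈C_n^+} x^{pk(π)} and V_n(x) = Σ_{π∈C_n^+} x^{val(π)} (with U_0(x) = 1 and V_0(x) = 0). -/

import Mathlib

open Polynomial Finset

/-- A signed permutation of rank `n`, encoded as a permutation of `Fin n`
together with a sign for each position. -/
abbrev SPerm (n : ℕ) := Equiv.Perm (Fin n) × (Fin n → Bool)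

/-- The value `π(i)` of a signed permutation at position `i ∈ [n]` (1-indexed),
with the convention `π(0) = 0` (and value `0` outside `[0, n]`). -/
def sval (n : ℕ) (π : SPerm n) (i : ℕ) : ℤ :=
  if h : 1 ≤ i ∧ i ≤ n then
    (if π.2 ⟨i - 1, by omega⟩ then -1 else 1) * ((π.1 ⟨i - 1, by omega⟩ : Fin n).val + 1)
  else 0

/-- The peak number `pk(π) = #{i ∈ [n-1] : π(i-1) < π(i) > π(i+1)}`,
with `π(0) = 0`. -/
def pkB (n : ℕ) (π : SPerm n) : ℕ :=
  ((Finset.Icc 1 (n - 1)).filter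
    (fun i => sval n π (i - 1) < sval n π i ∧ sval n π (i + 1) < sval n π i)).card

/-- The valley number `val(π) = #{i ∈ [n-1] : π(i-1) > π(i) < π(i+1)}`,
with `π(0) = 0`. -/
def valB (n : ℕ) (π : SPerm n) : ℕ :=
  ((Finset.Icc 1 (n - 1)).filter
    (fun i => sval n π i < sval n π (i - 1) ∧ sval n π i < sval n π (i + 1))).card

/-- `U_n(x) = Σ_{π ∈ C_n^+} x^{pk(π)}`, with the convention `U_0(x) = 1`. -/
noncomputable def Upoly (n : ℕ) : Polynomial ℝ :=
  if n = 0 then 1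
  else
    ∑ π ∈ Finset.univ.filter (fun π : SPerm n => 0 < sval n π 1), X ^ pkB n π

/-- `V_n(x) = Σ_{π ∈ C_n^+} x^{val(π)}`, with the convention `V_0(x) = 0`. -/
noncomputable def Vpoly (n : ℕ) : Polynomial ℝ :=
  if n = 0 then 0
  else
    ∑ π ∈ Finset.univ.filter (fun π : SPerm n => 0 < sval n π 1), X ^ valB n π

/-- The number of direction changes in the sequence of steps `d` followed by a final up step
(`true` is an up step). -/
def numTurns : List Bool → ℕ
  | [] => 0
  | a :: t => (if a = t.headD true then 0 else 1) + numTurns t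

/-- The step sequences obtained from `d` when a new maximum or a new minimum is inserted
after some entry of the underlying word. -/
def stepInsertions : List Bool → List (List Bool)
  | [] => [[true], [false]]
  | a :: t => (true :: false :: t) :: (false :: true :: t) :: (stepInsertions t).map (a :: ·)

/-- The step sequence of the word `l` preceded by the value `a`. -/
def steps : ℤ → List ℤ → List Bool
  | _, [] => []
  | a, b :: t => decide (a < b) :: steps b t

section Turns

variable {R : Type*} [CommRing R] (x : R)

theorem sum_stepInsertions_cons (d : List Bool) (a : Bool) :
    ((stepInsertions d).map fun d' => x ^ numTurns (a :: d')).sum =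
      (2 * numTurns (a :: d) + 1 - if a = d.headD true then 0 else 1) * x ^ numTurns (a :: d) +
      (2 * d.length + 1 - 2 * numTurns (a :: d) + if a = d.headD true then 0 else 1) *
        x ^ (numTurns (a :: d) + 2) := by
  induction d generalizing a with
  | nil => cases a <;> simp [stepInsertions, numTurns]; ring
  | cons b t ih =>
    have h : ((stepInsertions t).map fun d' => x ^ numTurns (a :: b :: d')).sum =
        x ^ (if a = b then 0 else 1) *
          ((stepInsertions t).map fun d' => x ^ numTurns (b :: d')).sum := by
      rw [← List.sum_map_mul_left]
      simp only [← pow_add]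
      rfl
    simp only [stepInsertions, List.map_cons, List.sum_cons, List.map_map, Function.comp_def]
    rw [h, ih b]
    simp only [numTurns, List.headD_cons, List.length_cons]
    generalize t.headD true = c
    generalize numTurns t = k
    cases a <;> cases b <;> cases c <;> simp <;> ring

theorem sum_stepInsertions (d : List Bool) :
    ((stepInsertions d).map fun d' => x ^ numTurns d').sum =
      (2 * numTurns d + 1) * x ^ numTurns d + x ^ (numTurns d + 1) +
      (2 * d.length - 2 * numTurns d) * x ^ (numTurns d + 2) := by
  cases d with
  | nil => simp [stepInsertions, numTurns]
  | cons a t =>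
    simp only [stepInsertions, List.map_cons, List.sum_cons, List.map_map, Function.comp_def]
    rw [sum_stepInsertions_cons]
    simp only [numTurns, List.headD_cons, List.length_cons]
    generalize t.headD true = c
    generalize numTurns t = k
    cases a <;> cases c <;> simp <;> ring

end Turns

@[simp]
theorem length_steps (a : ℤ) (l : List ℤ) : (steps a l).length = l.length := by
  induction l generalizing a with
  | nil => rfl
  | cons b t ih => simp [steps, ih]

theorem sum_steps_insertIdx {R : Type*} [AddCommMonoid R] (f : List Bool → R) (M : ℤ)
    (l : List ℤ) (a : ℤ) (ha : |a| < M) (hl : ∀ b ∈ l, |b| < M) :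
    ∑ i ∈ range (l.length + 1),
        (f (steps a (l.insertIdx i M)) + f (steps a (l.insertIdx i (-M)))) =
      ((stepInsertions (steps a l)).map f).sum := by
  have ha' := abs_lt.1 ha
  induction l generalizing a f with
  | nil => simp [steps, stepInsertions, ha'.2, ha'.1.not_gt]
  | cons b t ih =>
    have hb := hl b (by simp)
    have hb' := abs_lt.1 hb
    rw [List.length_cons, sum_range_succ']
    simp only [List.insertIdx_succ_cons, List.insertIdx_zero, steps]
    rw [ih (fun d => f (decide (a < b) :: d)) b hb (fun c hc => hl c (by simp [hc])) hb']
    simp [stepInsertions, ha'.2, ha'.1.not_gt, hb'.1, hb'.2.not_gt, Function.comp_def]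
    abel

theorem steps_map_range (n : ℕ) (w : ℕ → ℤ) :
    steps (w 0) ((List.range n).map fun i => w (i + 1)) =
      (List.range n).map fun i => decide (w i < w (i + 1)) := by
  induction n generalizing w with
  | zero => rfl
  | succ n ih =>
    simp only [List.range_succ_eq_map, List.map_cons, List.map_map, steps]
    exact congrArg _ (ih fun i => w (i + 1))

theorem numTurns_map_range (m : ℕ) (d : ℕ → Bool) :
    numTurns ((List.range (m + 1)).map d) =
      2 * (∑ i ∈ range m, if d i = true ∧ d (i + 1) = false then 1 else 0) +
        if d 0 = true then 0 else 1 := by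
  induction m generalizing d with
  | zero => simp [numTurns]
  | succ m ih =>
    have h := ih fun i => d (i + 1)
    rw [sum_range_succ', List.range_succ_eq_map, List.map_cons, List.map_map, numTurns]
    simp only [Function.comp_def, Nat.succ_eq_add_one]
    rw [h, List.range_succ_eq_map]
    simp only [List.map_cons, List.headD_cons, zero_add]
    cases d 0 <;> cases d 1 <;> simp <;> ring

/-- The word `π(1), …, π(n)` of a signed permutation. -/
def signedWord {n : ℕ} (π : SPerm n) (i : Fin n) : ℤ :=
  (if π.2 i then -1 else 1) * ((π.1 i).val + 1)

theorem sval_succ {n : ℕ} (π : SPerm n) (i : Fin n) : sval n π (i + 1) = signedWord π i := by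
  simp [sval, signedWord]

@[simp]
theorem sval_zero {n : ℕ} (π : SPerm n) : sval n π 0 = 0 := by simp [sval]

theorem abs_signedWord {n : ℕ} (π : SPerm n) (i : Fin n) :
    |signedWord π i| = (π.1 i).val + 1 := by
  unfold signedWord
  split_ifs
  · rw [neg_one_mul, abs_neg, abs_of_nonneg (by positivity)]
  · rw [one_mul, abs_of_nonneg (by positivity)]

theorem ofFn_signedWord {n : ℕ} (π : SPerm n) :
    List.ofFn (signedWord π) = (List.range n).map fun i => sval n π (i + 1) := by
  apply List.ext_getElem
  · simp
  · intro i h _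
    simpa using (sval_succ π ⟨i, by simpa using h⟩).symm

theorem sval_ne_succ {n : ℕ} (π : SPerm n) {i : ℕ} (hi : i < n) :
    sval n π i ≠ sval n π (i + 1) := by
  have h1 := sval_succ π ⟨i, hi⟩
  have h2 := abs_signedWord π ⟨i, hi⟩
  rw [← h1] at h2
  intro h
  rw [← h] at h2
  cases i with
  | zero => simp at h2; omega
  | succ j =>
    have h3 := abs_signedWord π ⟨j, by omega⟩
    rw [← sval_succ] at h3
    rw [h3] at h2
    have h4 : π.1 ⟨j, by omega⟩ = π.1 ⟨j + 1, hi⟩ := Fin.ext (by omega)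
    simpa using π.1.injective h4

/-- The number of direction changes in the word `0, π(1), …, π(n), ∞`. -/
def turns {n : ℕ} (π : SPerm n) : ℕ := numTurns (steps 0 (List.ofFn (signedWord π)))

theorem turns_eq {n : ℕ} (hn : n ≠ 0) (π : SPerm n) :
    turns π = 2 * pkB n π + if 0 < sval n π 1 then 0 else 1 := by
  obtain ⟨m, rfl⟩ := Nat.exists_eq_succ_of_ne_zero hn
  have h := steps_map_range (m + 1) (sval (m + 1) π)
  rw [sval_zero] at h
  rw [turns, ofFn_signedWord, h, numTurns_map_range, pkB, card_filter]
  have hI : Icc 1 (m + 1 - 1) = Ico 1 (m + 1) := by ext; simp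
  rw [hI, sum_Ico_eq_sum_range]
  simp only [decide_eq_true_eq, decide_eq_false_iff_not, sval_zero, zero_add,
    Nat.add_sub_cancel]
  congr 2
  refine sum_congr rfl fun i hi => ?_
  have hne : sval (m + 1) π (i + 1) ≠ sval (m + 1) π (i + 1 + 1) :=
    sval_ne_succ π (by simpa using hi)
  rw [add_comm 1 i, Nat.add_sub_cancel]
  refine if_congr (and_congr_right fun _ => ?_) rfl rfl
  rw [not_lt]
  exact ⟨fun h => h.lt_of_ne hne.symm, le_of_lt⟩

/-- Insertion of the value `±(n+1)` at position `p` of a signed permutation of rank `n`. -/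
def insertMax {n : ℕ} (q : SPerm n × Fin (n + 1) × Bool) : SPerm (n + 1) :=
  (((finSuccEquiv' q.2.1).trans q.1.1.optionCongr).trans (finSuccEquiv' (Fin.last n)).symm,
    q.2.1.insertNth q.2.2 q.1.2)

theorem insertMax_injective {n : ℕ} : Function.Injective (insertMax (n := n)) := by
  rintro ⟨⟨σ, s⟩, p, b⟩ ⟨⟨τ, t⟩, q, c⟩ h
  have hσ := congrArg Prod.fst h
  have hs := congrArg Prod.snd h
  simp only [insertMax] at hσ hs
  obtain rfl : p = q := by
    have h1 := congrArg (fun e => e.symm (Fin.last n)) hσ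
    simpa [← Equiv.optionCongr_symm] using h1
  obtain rfl : σ = τ := by
    ext j : 1
    have h1 := congrArg (fun e => e (p.succAbove j)) hσ
    simpa using h1
  have hb := congrFun hs p
  have ht : s = t := by
    ext j
    simpa using congrFun hs (p.succAbove j)
  simp_all

theorem insertMax_bijective {n : ℕ} : Function.Bijective (insertMax (n := n)) := by
  rw [Fintype.bijective_iff_injective_and_card]
  refine ⟨insertMax_injective, ?_⟩
  simp [Fintype.card_perm, Nat.factorial_succ, pow_succ]
  ring

theorem ofFn_insertNth {α : Type*} {n : ℕ} (p : Fin (n + 1)) (a : α) (w : Fin n → α) :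
    List.ofFn (p.insertNth (α := fun _ => α) a w) = (List.ofFn w).insertIdx p a := by
  induction n with
  | zero =>
    obtain rfl : p = 0 := Fin.fin_one_eq_zero p
    simp
  | succ n ih =>
    cases p using Fin.cases with
    | zero => simp [List.ofFn_succ]
    | succ p =>
      rw [List.ofFn_succ, List.ofFn_succ (f := w), Fin.val_succ, List.insertIdx_succ_cons, ← ih]
      have hz : p.succ.insertNth (α := fun _ => α) a w 0 = w 0 := by
        rw [← Fin.succ_succAbove_zero p, Fin.insertNth_apply_succAbove]
      have hs (i : Fin (n + 1)) : p.succ.insertNth (α := fun _ => α) a w i.succ =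
          p.insertNth (α := fun _ => α) a (fun j => w j.succ) i := by
        cases i using Fin.succAboveCases p with
        | x => simp
        | p j => rw [← Fin.succ_succAbove_succ]; simp only [Fin.insertNth_apply_succAbove]
      simp only [hz, hs]

theorem signedWord_insertMax {n : ℕ} (π : SPerm n) (p : Fin (n + 1)) (b : Bool) :
    signedWord (insertMax (π, p, b)) =
      p.insertNth (α := fun _ => ℤ) (if b then -((n : ℤ) + 1) else n + 1) (signedWord π) := by
  refine (Fin.eq_insertNth_iff).2 ⟨?_, ?_⟩
  · cases b <;> simp [signedWord, insertMax]
  · ext j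
    simp [signedWord, insertMax, Fin.removeNth]

theorem sum_pow_turns_succ {R : Type*} [CommRing R] (x : R) (n : ℕ) :
    ∑ π : SPerm (n + 1), x ^ turns π =
      ∑ π : SPerm n, ((2 * turns π + 1) * x ^ turns π + x ^ (turns π + 1) +
        (2 * n - 2 * turns π) * x ^ (turns π + 2)) := by
  rw [← insertMax_bijective.sum_comp, Fintype.sum_prod_type]
  refine sum_congr rfl fun π _ => ?_
  have h1 := sum_stepInsertions x (steps 0 (List.ofFn (signedWord π)))
  have h2 := sum_steps_insertIdx (fun d => x ^ numTurns d) ((n : ℤ) + 1)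
    (List.ofFn (signedWord π)) 0 (by simp only [abs_zero]; positivity) (by
      simp only [List.mem_ofFn, forall_exists_index, forall_apply_eq_imp_iff]
      intro i
      rw [abs_signedWord]
      have := (π.1 i).isLt
      omega)
  rw [← h2] at h1
  simp only [length_steps, List.length_ofFn] at h1
  simp only [turns]
  rw [← h1, ← Fin.sum_univ_eq_sum_range
    (fun i => x ^ numTurns (steps 0 ((List.ofFn (signedWord π)).insertIdx i ((n : ℤ) + 1))) +
      x ^ numTurns (steps 0 ((List.ofFn (signedWord π)).insertIdx i (-((n : ℤ) + 1)))))]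
  rw [Fintype.sum_prod_type]
  refine sum_congr rfl fun p _ => ?_
  rw [Fintype.sum_bool, signedWord_insertMax, signedWord_insertMax, ofFn_insertNth,
    ofFn_insertNth, add_comm]
  simp

/-- The signed permutation `-π`. -/
def negSPerm {n : ℕ} (π : SPerm n) : SPerm n := (π.1, fun i => !π.2 i)

theorem negSPerm_involutive {n : ℕ} : Function.Involutive (negSPerm (n := n)) := fun π => by
  simp [negSPerm]

theorem sval_negSPerm {n : ℕ} (π : SPerm n) (i : ℕ) :
    sval n (negSPerm π) i = -sval n π i := by
  unfold sval negSPerm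
  split_ifs <;> simp_all

theorem pkB_negSPerm {n : ℕ} (π : SPerm n) : pkB n (negSPerm π) = valB n π := by
  simp [pkB, valB, sval_negSPerm]

theorem sum_pow_turns {n : ℕ} (hn : n ≠ 0) :
    ∑ π : SPerm n, (X : ℝ[X]) ^ turns π =
      (Upoly n).comp (X ^ 2) + X * (Vpoly n).comp (X ^ 2) := by
  rw [Upoly, Vpoly, if_neg hn, if_neg hn, Polynomial.sum_comp, Polynomial.sum_comp,
    ← sum_filter_add_sum_filter_not univ (fun π : SPerm n => 0 < sval n π 1), mul_sum]
  congr 1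
  · refine sum_congr rfl fun π hπ => ?_
    rw [turns_eq hn, if_pos (mem_filter.1 hπ).2]
    simp [pow_mul]
  · have hpos (π : SPerm n) : 0 < sval n (negSPerm π) 1 ↔ ¬ 0 < sval n π 1 := by
      have := sval_ne_succ π (Nat.pos_of_ne_zero hn)
      simp only [sval_zero, zero_add] at this
      rw [sval_negSPerm]
      omega
    refine sum_nbij' negSPerm negSPerm ?_ ?_ (fun π _ => negSPerm_involutive π)
      (fun π _ => negSPerm_involutive π) ?_
    · intro π hπ
      simpa [hpos] using hπ
    · intro π hπ
      rw [mem_filter] at hπ ⊢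
      exact ⟨mem_univ _, fun h => (hpos π).1 h hπ.2⟩
    · intro π hπ
      rw [turns_eq hn, if_neg (mem_filter.1 hπ).2, ← pkB_negSPerm, negSPerm_involutive]
      rw [X_pow_comp, ← pow_mul, pow_succ, mul_comm]

theorem X_mul_derivative_X_pow (k : ℕ) :
    (X : ℝ[X]) * derivative (X ^ k) = (k : ℝ[X]) * X ^ k := by
  cases k with
  | zero => simp
  | succ k =>
    rw [derivative_X_pow_succ, ← Nat.cast_succ, C_eq_natCast, pow_succ]
    ring

/-- If `H_{n+1}(x) = (2nx²+x+1)·H_n(x) + 2x(1-x²)·H_n'(x)` with `H_0(x) = 1`,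
then `H_n(x) = U_n(x²) + x·V_n(x²)` for every `n ≥ 0`. -/
theorem Hpoly_eq_U_V (H : ℕ → Polynomial ℝ)
    (hH0 : H 0 = 1)
    (hH : ∀ n : ℕ,
      H (n + 1) = (Polynomial.C (2 * (n : ℝ)) * X ^ 2 + X + 1) * H n +
        2 * X * (1 - X ^ 2) * derivative (H n)) :
    ∀ n : ℕ, H n = (Upoly n).comp (X ^ 2) + X * (Vpoly n).comp (X ^ 2) := by
  have key (n : ℕ) : H n = ∑ π : SPerm n, X ^ turns π := by
    induction n with
    | zero => simp [hH0, turns, steps, numTurns]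
    | succ n ih =>
      rw [hH, sum_pow_turns_succ, ih, derivative_sum, mul_sum, mul_sum, ← sum_add_distrib]
      refine sum_congr rfl fun π _ => ?_
      have h := X_mul_derivative_X_pow (turns π)
      have hC : (C (2 * (n : ℝ)) : ℝ[X]) = 2 * n := by
        rw [C_mul, C_ofNat, C_eq_natCast]
      rw [hC]
      linear_combination (2 * (1 - X ^ 2)) * h
  intro n
  rcases eq_or_ne n 0 with rfl | hn
  · simp [hH0, Upoly, Vpoly]
  · rw [key, sum_pow_turns hn]
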